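/- Let (Λ_Q, f) be a C^{1+Lip} expansive and transitive Markov system. Then the set Λ_Q has Lebesgue measure zero. -/

import Mathlib

open Set Metric Filter MeasureTheory
open scoped Classical

/-- The word `[ω 0, ω 1, …, ω (n-1)]` read off from the sequence `ω`. -/
def wordOf {p : ℕ} (ω : ℕ → Fin p) (n : ℕ) : List (Fin p) :=
  (List.range n).map ω

/-- The cylinder sets `Δ_{i₁…iₙ} = g_{i₁…i_{n-1}}(I_{iₙ})` of the iterated function
system given by the big interval `I`, the subintervals `Isub i` and the maps `g i`;
by convention `Δ_∅ = I`. -/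
def cylOf {p : ℕ} (I : Set ℝ) (Isub : Fin p → Set ℝ) (g : Fin p → ℝ → ℝ) :
    List (Fin p) → Set ℝ
  | [] => I
  | [i] => Isub i
  | i :: j :: w => g i '' cylOf I Isub g (j :: w)

/-- The sequence `ω` contains the word `w` as a sub-word starting at position `n`. -/
def containsAt {p : ℕ} (ω : ℕ → Fin p) (w : List (Fin p)) (n : ℕ) : Prop :=
  ∀ k : ℕ, (hk : k < w.length) → ω (n + k) = w.get ⟨k, hk⟩

/-- The sequence `ω` belongs to `Σ_Q`, i.e. it contains no word of `Q` as a sub-word. -/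
def avoids {p : ℕ} (Q : Finset (List (Fin p))) (ω : ℕ → Fin p) : Prop :=
  ∀ w ∈ Q, ∀ n : ℕ, ¬ containsAt ω w n

/-- The limit set `Λ_Q = π(Σ_Q)`: points lying, for some `ω ∈ Σ_Q`, in all the
cylinders `Δ_{ω₀…ω_{n-1}}`. -/
def limitSetOf {p : ℕ} (I : Set ℝ) (Isub : Fin p → Set ℝ) (g : Fin p → ℝ → ℝ)
    (Q : Finset (List (Fin p))) : Set ℝ :=
  { x | ∃ ω : ℕ → Fin p, avoids Q ω ∧ ∀ n : ℕ, x ∈ cylOf I Isub g (wordOf ω n) }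

/-- `gIter g ω n = g_{i_n … i_1} = g_{ω (n-1)} ∘ ⋯ ∘ g_{ω 0}`. -/
def gIter {p : ℕ} (g : Fin p → ℝ → ℝ) (ω : ℕ → Fin p) : ℕ → ℝ → ℝ
  | 0 => id
  | n + 1 => g (ω n) ∘ gIter g ω n

/-- The derivative of the composition `gIter g ω n` at `x` (chain rule product). -/
noncomputable def gIterDer {p : ℕ} (g gder : Fin p → ℝ → ℝ) (ω : ℕ → Fin p)
    (n : ℕ) (x : ℝ) : ℝ :=
  ∏ k ∈ Finset.range n, gder (ω k) (gIter g ω k x)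

/-- Prepending the finite word `w` to the infinite sequence `ω`. -/
def prependWord {p : ℕ} (w : List (Fin p)) (ω : ℕ → Fin p) : ℕ → Fin p :=
  fun n => if h : n < w.length then w.get ⟨n, h⟩ else ω (n - w.length)

/-- `l(Σ_Q)`: the minimum, over all finite sets `Q'` of words with `Σ_{Q'} = Σ_Q`,
of the maximal length `l(Q')` of words of `Q'`. -/
noncomputable def minRepLen {p : ℕ} (Q : Finset (List (Fin p))) : ℕ :=
  sInf { n : ℕ | ∃ Q' : Finset (List (Fin p)),
    (∀ ω : ℕ → Fin p, avoids Q' ω ↔ avoids Q ω) ∧ Q'.sup List.length = n }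

/-- A `C^{1+Lip}` expansive and transitive Markov system `(Λ_Q, f)`. -/
structure ExpansiveMarkovSystem (p : ℕ) where
  /-- the alphabet is nonempty -/
  hp : 0 < p
  /-- the ambient closed interval `I` -/
  I : Set ℝ
  hI : ∃ a b : ℝ, a < b ∧ I = Set.Icc a b
  /-- the pairwise disjoint closed subintervals `I₁, …, I_p` -/
  Isub : Fin p → Set ℝ
  hIsub : ∀ i, ∃ a b : ℝ, a < b ∧ Isub i = Set.Icc a b
  hsubI : ∀ i, Isub i ⊆ I
  hdisj : ∀ i j, i ≠ j → Disjoint (Isub i) (Isub j)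
  /-- the contractions `g i`, defined on `⋃ j, Isub j` -/
  g : Fin p → ℝ → ℝ
  /-- the derivative of `g i` on `⋃ j, Isub j` -/
  gder : Fin p → ℝ → ℝ
  hg_inj : ∀ i, Set.InjOn (g i) (⋃ j, Isub j)
  hg_range : ∀ i, g i '' (⋃ j, Isub j) ⊆ interior (Isub i)
  hg_deriv : ∀ i, ∀ x ∈ ⋃ j, Isub j,
    HasDerivWithinAt (g i) (gder i x) (⋃ j, Isub j) x
  hgder_ne : ∀ i, ∀ x ∈ ⋃ j, Isub j, gder i x ≠ 0
  hgder_cont : ∀ i, ContinuousOn (gder i) (⋃ j, Isub j)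
  /-- `log |g i'|` is Lipschitz on the domain -/
  hgder_lip : ∀ i, ∃ θ : ℝ, ∀ x ∈ ⋃ j, Isub j, ∀ y ∈ ⋃ j, Isub j,
    abs (Real.log (abs (gder i x)) - Real.log (abs (gder i y))) ≤ θ * |x - y|
  /-- the expanding map `f`, with `f (g i x) = x` -/
  f : ℝ → ℝ
  /-- the derivative `f'` of `f` on the ranges of the `g i` -/
  fder : ℝ → ℝ
  hf : ∀ i, ∀ x ∈ ⋃ j, Isub j, f (g i x) = x
  hfder : ∀ i, ∀ x ∈ ⋃ j, Isub j, fder (g i x) = (gder i x)⁻¹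
  /-- the generator (expansivity) condition: `d_n → 0` -/
  hgen : ∀ ε : ℝ, 0 < ε → ∃ N : ℕ, ∀ w : List (Fin p), N ≤ w.length →
    Metric.diam (cylOf I Isub g w) < ε
  /-- the finite set of forbidden words -/
  Q : Finset (List (Fin p))
  /-- `Σ_Q` is completely invariant: `σ(Σ_Q) = Σ_Q` -/
  hQinv : ∀ ω : ℕ → Fin p, avoids Q ω →
    ∃ ω' : ℕ → Fin p, avoids Q ω' ∧ ∀ n : ℕ, ω' (n + 1) = ω n
  /-- `f|Λ_Q` is topologically transitive -/
  htrans : ∀ U V : Set ℝ, IsOpen U → IsOpen V →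
    (U ∩ limitSetOf I Isub g Q).Nonempty → (V ∩ limitSetOf I Isub g Q).Nonempty →
    ∃ n : ℕ, ∃ x ∈ U ∩ limitSetOf I Isub g Q, f^[n] x ∈ V

namespace ExpansiveMarkovSystem

variable {p : ℕ} (S : ExpansiveMarkovSystem p)

/-- The common domain `⋃ j, I_j` of the maps `g i`. -/
def dom : Set ℝ := ⋃ j, S.Isub j

/-- The cylinder `Δ_w` associated to the word `w`. -/
def cyl (w : List (Fin p)) : Set ℝ := cylOf S.I S.Isub S.g w

/-- The limit set `Λ_Q`. -/
def limitSet : Set ℝ := limitSetOf S.I S.Isub S.g S.Q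

/-- The domain of `f`, i.e. the union of the ranges of the `g i`. -/
def domF : Set ℝ := ⋃ i, S.g i '' S.dom

/-- The derivative `(fⁿ)'(x)` of the `n`-th iterate of `f` at `x`. -/
noncomputable def derIter (n : ℕ) (x : ℝ) : ℝ :=
  ∏ k ∈ Finset.range n, S.fder (S.f^[k] x)

/-- The Lyapunov exponent `χ(x) = limsup (1/n) log |(fⁿ)'(x)|`. -/
noncomputable def lyap (x : ℝ) : ℝ :=
  Filter.limsup (fun n : ℕ => Real.log |S.derIter n x| / n) Filter.atTop

/-- The set `H` of points of `Λ_Q` with infinitely many hyperbolic instants. -/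
def hypSet : Set ℝ :=
  { x ∈ S.limitSet | ∃ c₁ : ℝ, 0 < c₁ ∧ ∃ c₂ : ℝ, 0 < c₂ ∧
      ∃ n : ℕ → ℕ, StrictMono n ∧
        ∃ r : ℕ → ℝ, (∀ k, 0 < r k) ∧ Antitone r ∧
          Filter.Tendsto r Filter.atTop (nhds 0) ∧
          ∀ k : ℕ,
            (∀ y ∈ Metric.ball x (r k), ∀ j < n k, S.f^[j] y ∈ S.domF) ∧
            c₁ < Metric.diam (S.f^[n k] '' Metric.ball x (r k)) ∧
            (∀ y ∈ Metric.ball x (r k), ∀ z ∈ Metric.ball x (r k),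
              |S.derIter (n k) y| / |S.derIter (n k) z| < c₂) }

/-- `x` is a parabolic periodic point: `f^m(x) = x` and `|(f^m)'(x)| = 1`. -/
def IsParabolicPeriodic (x : ℝ) : Prop :=
  x ∈ S.limitSet ∧ ∃ m : ℕ, 1 ≤ m ∧ S.f^[m] x = x ∧ |S.derIter m x| = 1

/-- `ν` is a `t`-conformal (Borel probability) measure supported on `Λ_Q`. -/
def IsConformal (ν : Measure ℝ) (t : ℝ) : Prop :=
  IsProbabilityMeasure ν ∧ ν S.limitSetᶜ = 0 ∧
    ∀ A : Set ℝ, MeasurableSet A → A ⊆ S.limitSet → Set.InjOn S.f A →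
      ν (S.f '' A) = ∫⁻ x in A, ENNReal.ofReal (|S.fder x| ^ t) ∂ν

/-- `t_c = inf {t ≥ 0 : a t-conformal measure on Λ_Q exists}`. -/
noncomputable def tc : ℝ :=
  sInf { t : ℝ | 0 ≤ t ∧ ∃ ν : Measure ℝ, S.IsConformal ν t }

/-- `n` is a hyperbolic time for `x` with exponent `α`. -/
def IsHypTime (α : ℝ) (x : ℝ) (n : ℕ) : Prop :=
  ∀ k : ℕ, 1 ≤ k → k ≤ n → Real.exp (k * α) ≤ |S.derIter k (S.f^[n - k] x)|

/-- `H_HT(α)`: the points of `Λ_Q` with infinitely many hyperbolic times with exponent `α`. -/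
def HHT (α : ℝ) : Set ℝ :=
  { x ∈ S.limitSet | ∀ N : ℕ, ∃ n : ℕ, N ≤ n ∧ S.IsHypTime α x n }

end ExpansiveMarkovSystem

namespace ExpansiveMarkovSystem

variable {p : ℕ} (S : ExpansiveMarkovSystem p)

/-- The composition `g_{i₁} ∘ ⋯ ∘ g_{iₙ}` attached to a finite word. -/
def wordMap : List (Fin p) → ℝ → ℝ
  | [] => id
  | i :: w => S.g i ∘ wordMap w

/-- The length of the cylinder of a word. -/
noncomputable def len (w : List (Fin p)) : ℝ := Metric.diam (S.cyl w)

lemma wordMap_append (u v : List (Fin p)) (x : ℝ) :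
    S.wordMap (u ++ v) x = S.wordMap u (S.wordMap v x) := by
  induction u with
  | nil => rfl
  | cons i u ih => simp [wordMap, ih]

lemma cyl_cons (i : Fin p) {w : List (Fin p)} (hw : w ≠ []) :
    S.cyl (i :: w) = S.g i '' S.cyl w := by
  cases w with
  | nil => exact absurd rfl hw
  | cons j w => rfl

lemma cyl_append (u : List (Fin p)) {v : List (Fin p)} (hv : v ≠ []) :
    S.cyl (u ++ v) = S.wordMap u '' S.cyl v := by
  induction u with
  | nil => simp [wordMap]
  | cons i u ih =>
    rw [List.cons_append, S.cyl_cons i (by simp [hv]), ih, wordMap, Set.image_comp]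

lemma Isub_subset_dom (i : Fin p) : S.Isub i ⊆ S.dom := Set.subset_iUnion S.Isub i

lemma image_g_subset (i : Fin p) {A : Set ℝ} (hA : A ⊆ S.dom) : S.g i '' A ⊆ S.Isub i :=
  (Set.image_mono hA).trans ((S.hg_range i).trans interior_subset)

lemma cyl_cons_subset_Isub (i : Fin p) (w : List (Fin p)) : S.cyl (i :: w) ⊆ S.Isub i := by
  induction w generalizing i with
  | nil => exact subset_rfl
  | cons j w ih =>
    rw [S.cyl_cons i (by simp)]
    exact S.image_g_subset i ((ih j).trans (S.Isub_subset_dom j))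

lemma cyl_subset_dom {w : List (Fin p)} (hw : w ≠ []) : S.cyl w ⊆ S.dom := by
  cases w with
  | nil => exact absurd rfl hw
  | cons i w => exact (S.cyl_cons_subset_Isub i w).trans (S.Isub_subset_dom i)

lemma continuousOn_g (i : Fin p) : ContinuousOn (S.g i) S.dom :=
  fun x hx => (S.hg_deriv i x hx).continuousWithinAt

lemma mapsTo_g (i : Fin p) : Set.MapsTo (S.g i) S.dom S.dom := fun x hx =>
  S.Isub_subset_dom i (S.image_g_subset i subset_rfl ⟨x, hx, rfl⟩)

lemma mapsTo_wordMap (u : List (Fin p)) : Set.MapsTo (S.wordMap u) S.dom S.dom := by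
  induction u with
  | nil => exact Set.mapsTo_id _
  | cons i u ih => exact (S.mapsTo_g i).comp ih

lemma continuousOn_wordMap (u : List (Fin p)) : ContinuousOn (S.wordMap u) S.dom := by
  induction u with
  | nil => exact continuousOn_id
  | cons i u ih => exact (S.continuousOn_g i).comp ih (S.mapsTo_wordMap u)

lemma injOn_wordMap (u : List (Fin p)) : Set.InjOn (S.wordMap u) S.dom := by
  induction u with
  | nil => exact Set.injOn_id _
  | cons i u ih => exact Set.InjOn.comp (S.hg_inj i) ih (S.mapsTo_wordMap u)

lemma isPreconnected_cyl {w : List (Fin p)} (hw : w ≠ []) : IsPreconnected (S.cyl w) := by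
  induction w with
  | nil => exact absurd rfl hw
  | cons i w ih =>
    cases w with
    | nil =>
      obtain ⟨a, b, -, h⟩ := S.hIsub i
      change IsPreconnected (S.Isub i)
      rw [h]
      exact isPreconnected_Icc
    | cons j w =>
      rw [S.cyl_cons i (by simp)]
      exact (ih (by simp)).image _ ((S.continuousOn_g i).mono (S.cyl_subset_dom (by simp)))

lemma isCompact_cyl {w : List (Fin p)} (hw : w ≠ []) : IsCompact (S.cyl w) := by
  induction w with
  | nil => exact absurd rfl hw
  | cons i w ih =>
    cases w with
    | nil =>
      obtain ⟨a, b, -, h⟩ := S.hIsub i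
      change IsCompact (S.Isub i)
      rw [h]
      exact isCompact_Icc
    | cons j w =>
      rw [S.cyl_cons i (by simp)]
      exact (ih (by simp)).image_of_continuousOn
        ((S.continuousOn_g i).mono (S.cyl_subset_dom (by simp)))

lemma nontrivial_cyl {w : List (Fin p)} (hw : w ≠ []) : (S.cyl w).Nontrivial := by
  induction w with
  | nil => exact absurd rfl hw
  | cons i w ih =>
    cases w with
    | nil =>
      obtain ⟨a, b, hab, h⟩ := S.hIsub i
      change (S.Isub i).Nontrivial
      rw [h]
      exact ⟨a, ⟨le_rfl, hab.le⟩, b, ⟨hab.le, le_rfl⟩, hab.ne⟩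
    | cons j w =>
      rw [S.cyl_cons i (by simp)]
      exact (ih (by simp)).image_of_injOn ((S.hg_inj i).mono (S.cyl_subset_dom (by simp)))

lemma cyl_eq_Icc {w : List (Fin p)} (hw : w ≠ []) :
    ∃ a b : ℝ, a < b ∧ S.cyl w = Set.Icc a b := by
  have h := eq_Icc_of_connected_compact ⟨(S.nontrivial_cyl hw).nonempty, S.isPreconnected_cyl hw⟩
    (S.isCompact_cyl hw)
  refine ⟨_, _, ?_, h⟩
  obtain ⟨x, hx, y, hy, hxy⟩ := S.nontrivial_cyl hw
  rw [h] at hx hy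
  by_contra hle
  exact hxy (by linarith [hx.1, hx.2, hy.1, hy.2])

lemma volume_cyl {w : List (Fin p)} (hw : w ≠ []) :
    volume (S.cyl w) = ENNReal.ofReal (S.len w) := by
  obtain ⟨a, b, hab, h⟩ := S.cyl_eq_Icc hw
  rw [len, h, Real.volume_Icc, Real.diam_Icc hab.le]

lemma len_pos {w : List (Fin p)} (hw : w ≠ []) : 0 < S.len w := by
  obtain ⟨a, b, hab, h⟩ := S.cyl_eq_Icc hw
  rw [len, h, Real.diam_Icc hab.le]
  linarith

lemma abs_sub_le_len {w : List (Fin p)} (hw : w ≠ []) {x y : ℝ} (hx : x ∈ S.cyl w)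
    (hy : y ∈ S.cyl w) : |x - y| ≤ S.len w := by
  rw [← Real.dist_eq]
  exact Metric.dist_le_diam_of_mem (S.isCompact_cyl hw).isBounded hx hy

lemma exists_abs_sub_eq_len {w : List (Fin p)} (hw : w ≠ []) :
    ∃ x ∈ S.cyl w, ∃ y ∈ S.cyl w, |x - y| = S.len w := by
  obtain ⟨a, b, hab, h⟩ := S.cyl_eq_Icc hw
  refine ⟨b, by rw [h]; exact ⟨hab.le, le_rfl⟩, a, by rw [h]; exact ⟨le_rfl, hab.le⟩, ?_⟩
  rw [len, h, Real.diam_Icc hab.le, abs_of_pos (by linarith)]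

lemma cyl_mono {v w : List (Fin p)} (hv : v ≠ []) (h : v <+: w) : S.cyl w ⊆ S.cyl v := by
  obtain ⟨t, rfl⟩ := h
  induction v with
  | nil => exact absurd rfl hv
  | cons i v ih =>
    cases v with
    | nil => exact S.cyl_cons_subset_Isub i t
    | cons j v =>
      rw [List.cons_append, S.cyl_cons i (by simp), S.cyl_cons i (by simp)]
      exact Set.image_mono (ih (by simp))

lemma measurableSet_cyl {w : List (Fin p)} (hw : w ≠ []) : MeasurableSet (S.cyl w) :=
  (S.isCompact_cyl hw).measurableSet

lemma prefix_or_prefix_of_mem {v w : List (Fin p)} {x : ℝ} (hv : x ∈ S.cyl v)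
    (hw : x ∈ S.cyl w) : v <+: w ∨ w <+: v := by
  induction v generalizing w x with
  | nil => exact Or.inl List.nil_prefix
  | cons i v ih =>
    cases w with
    | nil => exact Or.inr List.nil_prefix
    | cons j w =>
      have hij : i = j := by
        by_contra hne
        exact Set.disjoint_left.1 (S.hdisj i j hne) (S.cyl_cons_subset_Isub i v hv)
          (S.cyl_cons_subset_Isub j w hw)
      subst hij
      rcases eq_or_ne v [] with rfl | hv'
      · exact Or.inl (by simp)
      rcases eq_or_ne w [] with rfl | hw'
      · exact Or.inr (by simp)
      rw [S.cyl_cons i hv'] at hv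
      rw [S.cyl_cons i hw'] at hw
      obtain ⟨y, hy, rfl⟩ := hv
      obtain ⟨z, hz, hzy⟩ := hw
      obtain rfl := S.hg_inj i (S.cyl_subset_dom hw' hz) (S.cyl_subset_dom hv' hy) hzy
      simpa using ih hy hz

lemma disjoint_cyl {v w : List (Fin p)} (h₁ : ¬ v <+: w) (h₂ : ¬ w <+: v) :
    Disjoint (S.cyl v) (S.cyl w) :=
  Set.disjoint_left.2 fun _ hv hw => (S.prefix_or_prefix_of_mem hv hw).elim h₁ h₂

lemma exists_distortion_constant :
    ∃ θ : ℝ, 0 < θ ∧ ∀ i, ∀ x ∈ S.dom, ∀ y ∈ S.dom,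
      |Real.log (|S.gder i x|) - Real.log (|S.gder i y|)| ≤ θ * |x - y| := by
  choose θ hθ using S.hgder_lip
  refine ⟨∑ i, |θ i| + 1, by positivity, fun i x hx y hy => (hθ i x hx y hy).trans ?_⟩
  gcongr
  have := Finset.single_le_sum (f := fun i => |θ i|) (fun i _ => abs_nonneg _) (Finset.mem_univ i)
  linarith [le_abs_self (θ i)]

/-- A Lipschitz constant for the functions `log |g_i'|`. -/
noncomputable def distC : ℝ := S.exists_distortion_constant.choose

lemma distC_pos : 0 < S.distC := S.exists_distortion_constant.choose_spec.1

lemma abs_log_sub_le (i : Fin p) {x y : ℝ} (hx : x ∈ S.dom) (hy : y ∈ S.dom) :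
    |Real.log (|S.gder i x|) - Real.log (|S.gder i y|)| ≤ S.distC * |x - y| :=
  S.exists_distortion_constant.choose_spec.2 i x hx y hy

lemma exists_abs_gder_mul (i : Fin p) {J : Set ℝ} (hJ : J.OrdConnected) (hJd : J ⊆ S.dom) {x y : ℝ}
    (hx : x ∈ J) (hy : y ∈ J) :
    ∃ ξ ∈ J, |S.g i x - S.g i y| = |S.gder i ξ| * |x - y| := by
  wlog hxy : x < y generalizing x y
  · rcases eq_or_lt_of_le (not_lt.1 hxy) with rfl | h
    · exact ⟨_, hx, by simp⟩
    · obtain ⟨ξ, hξ, h'⟩ := this hy hx h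
      exact ⟨ξ, hξ, by rw [abs_sub_comm, h', abs_sub_comm x y]⟩
  have hsub : Set.Icc x y ⊆ J := hJ.out hx hy
  obtain ⟨ξ, hξ, h⟩ := exists_hasDerivAt_eq_slope (S.g i) (S.gder i) hxy
    ((S.continuousOn_g i).mono (hsub.trans hJd)) fun z hz =>
      (S.hg_deriv i z (hJd (hsub (Set.Ioo_subset_Icc_self hz)))).hasDerivAt
        (Filter.mem_of_superset (Icc_mem_nhds hz.1 hz.2) (hsub.trans hJd))
  refine ⟨ξ, hsub (Set.Ioo_subset_Icc_self hξ), ?_⟩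
  rw [h, abs_div, abs_sub_comm, abs_sub_comm x y, div_mul_cancel₀]
  exact abs_ne_zero.2 (by linarith)

lemma abs_gder_le (i : Fin p) {x y : ℝ} (hx : x ∈ S.dom) (hy : y ∈ S.dom) :
    |S.gder i x| ≤ Real.exp (S.distC * |x - y|) * |S.gder i y| := by
  have hx0 := abs_pos.2 (S.hgder_ne i x hx)
  have hy0 := abs_pos.2 (S.hgder_ne i y hy)
  have := (le_abs_self _).trans (S.abs_log_sub_le i hx hy)
  rw [← Real.exp_log hx0]
  rw [← Real.exp_log hy0]
  rw [← Real.exp_add, Real.exp_le_exp]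
  linarith

/-- The sum of the lengths of the cylinders `Δ_{u'v}` over the proper suffixes `u'` of `u`. -/
noncomputable def tot : List (Fin p) → List (Fin p) → ℝ
  | [], _ => 0
  | _ :: u, v => S.len (u ++ v) + tot u v

lemma tot_append (u u' v : List (Fin p)) :
    S.tot (u ++ u') v = S.tot u (u' ++ v) + S.tot u' v := by
  induction u with
  | nil => simp [tot]
  | cons i u ih => simp [tot, ih, add_assoc]

lemma wordMap_mem_cyl (u : List (Fin p)) {v : List (Fin p)} (hv : v ≠ []) {x : ℝ}
    (hx : x ∈ S.cyl v) : S.wordMap u x ∈ S.cyl (u ++ v) := by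
  rw [S.cyl_append u hv]
  exact Set.mem_image_of_mem _ hx

lemma distortion (u : List (Fin p)) {v : List (Fin p)} (hv : v ≠ []) {x y x' y' : ℝ}
    (hx : x ∈ S.cyl v) (hy : y ∈ S.cyl v) (hx' : x' ∈ S.cyl v) (hy' : y' ∈ S.cyl v) :
    |S.wordMap u x - S.wordMap u y| * |x' - y'| ≤
      Real.exp (S.distC * S.tot u v) * |S.wordMap u x' - S.wordMap u y'| * |x - y| := by
  induction u with
  | nil => simp [wordMap, tot, mul_comm]
  | cons i u ih =>
    have huv : u ++ v ≠ [] := by simp [hv]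
    have hJ := (S.isPreconnected_cyl huv).ordConnected
    have hd := S.cyl_subset_dom huv
    obtain ⟨ξ, hξ, h₁⟩ := S.exists_abs_gder_mul i hJ hd (S.wordMap_mem_cyl u hv hx)
      (S.wordMap_mem_cyl u hv hy)
    obtain ⟨η, hη, h₂⟩ := S.exists_abs_gder_mul i hJ hd (S.wordMap_mem_cyl u hv hx')
      (S.wordMap_mem_cyl u hv hy')
    have h₃ : |S.gder i ξ| ≤ Real.exp (S.distC * S.len (u ++ v)) * |S.gder i η| := by
      refine (S.abs_gder_le i (hd hξ) (hd hη)).trans ?_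
      gcongr
      · exact S.distC_pos.le
      · exact S.abs_sub_le_len huv hξ hη
    simp only [wordMap, tot, Function.comp_apply]
    rw [h₁, h₂, mul_add, Real.exp_add]
    calc _ = |S.gder i ξ| * (|S.wordMap u x - S.wordMap u y| * |x' - y'|) := by ring
      _ ≤ (Real.exp (S.distC * S.len (u ++ v)) * |S.gder i η|) *
          (Real.exp (S.distC * S.tot u v) * |S.wordMap u x' - S.wordMap u y'| * |x - y|) := by
        gcongr
      _ = _ := by ring

lemma len_append_le (u : List (Fin p)) {v w : List (Fin p)} (hv : v ≠ []) (hvw : v <+: w) :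
    S.len (u ++ w) * S.len v ≤ Real.exp (S.distC * S.tot u v) * S.len (u ++ v) * S.len w := by
  have hw : w ≠ [] := by rintro rfl; exact hv (List.prefix_nil.1 hvw)
  obtain ⟨x, hx, y, hy, hxy⟩ := S.exists_abs_sub_eq_len (w := u ++ w) (by simp [hw])
  obtain ⟨x', hx', y', hy', hxy'⟩ := S.exists_abs_sub_eq_len hv
  rw [S.cyl_append u hw] at hx hy
  obtain ⟨x, hx, rfl⟩ := hx
  obtain ⟨y, hy, rfl⟩ := hy
  have h := S.distortion u hv (S.cyl_mono hv hvw hx) (S.cyl_mono hv hvw hy) hx' hy'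
  rw [hxy, hxy'] at h
  refine h.trans ?_
  gcongr
  · exact mul_nonneg (Real.exp_pos _).le Metric.diam_nonneg
  · exact S.abs_sub_le_len (by simp [hv]) (S.wordMap_mem_cyl u hv hx') (S.wordMap_mem_cyl u hv hy')
  · exact S.abs_sub_le_len hw hx hy

lemma len_le_append (u : List (Fin p)) {v w : List (Fin p)} (hv : v ≠ []) (hvw : v <+: w) :
    S.len (u ++ v) * S.len w ≤ Real.exp (S.distC * S.tot u v) * S.len (u ++ w) * S.len v := by
  have hw : w ≠ [] := by rintro rfl; exact hv (List.prefix_nil.1 hvw)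
  obtain ⟨x, hx, y, hy, hxy⟩ := S.exists_abs_sub_eq_len (w := u ++ v) (by simp [hv])
  obtain ⟨x', hx', y', hy', hxy'⟩ := S.exists_abs_sub_eq_len hw
  rw [S.cyl_append u hv] at hx hy
  obtain ⟨x, hx, rfl⟩ := hx
  obtain ⟨y, hy, rfl⟩ := hy
  have h := S.distortion u hv hx hy (S.cyl_mono hv hvw hx') (S.cyl_mono hv hvw hy')
  rw [hxy, hxy'] at h
  refine h.trans ?_
  gcongr
  · exact mul_nonneg (Real.exp_pos _).le Metric.diam_nonneg
  · exact S.abs_sub_le_len (by simp [hw]) (S.wordMap_mem_cyl u hw hx') (S.wordMap_mem_cyl u hw hy')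
  · exact S.abs_sub_le_len hv hx hy

/-- No proper nonempty suffix `s` of `u` creates an occurrence of `v` at the start of `s ++ v`. -/
def NoEarly (u v : List (Fin p)) : Prop :=
  ∀ t s, t ≠ [] → s ≠ [] → u = t ++ s → ¬ v <+: s ++ v

lemma NoEarly.of_cons {i : Fin p} {u v : List (Fin p)} (h : NoEarly (i :: u) v) : NoEarly u v :=
  fun t s _ hs hu => h (i :: t) s (by simp) hs (by simp [hu])

/-- The union of the cylinders `Δ_{u'v}` over the proper suffixes `u'` of `u`. -/
def suffixUnion : List (Fin p) → List (Fin p) → Set ℝ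
  | [], _ => ∅
  | _ :: u, v => S.cyl (u ++ v) ∪ suffixUnion u v

lemma mem_suffixUnion {u v : List (Fin p)} {x : ℝ} :
    x ∈ S.suffixUnion u v ↔ ∃ t s, t ≠ [] ∧ u = t ++ s ∧ x ∈ S.cyl (s ++ v) := by
  induction u with
  | nil => simp [suffixUnion]
  | cons i u ih =>
    rw [suffixUnion, Set.mem_union, ih]
    constructor
    · rintro (h | ⟨t, s, ht, rfl, h⟩)
      · exact ⟨[i], u, by simp, rfl, h⟩
      · exact ⟨i :: t, s, by simp, rfl, h⟩
    · rintro ⟨t, s, ht, hu, h⟩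
      cases t with
      | nil => exact absurd rfl ht
      | cons j t =>
        obtain ⟨rfl, rfl⟩ := List.cons_eq_cons.1 hu
        rcases eq_or_ne t [] with rfl | ht'
        · exact Or.inl h
        · exact Or.inr ⟨t, s, ht', rfl, h⟩

lemma NoEarly.disjoint {i : Fin p} {u v : List (Fin p)} (h : NoEarly (i :: u) v) :
    Disjoint (S.cyl (u ++ v)) (S.suffixUnion u v) := by
  rw [Set.disjoint_right]
  intro x hx hx'
  obtain ⟨t, s, ht, rfl, hs⟩ := S.mem_suffixUnion.1 hx
  have htl := List.length_pos_iff.2 ht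
  rcases S.prefix_or_prefix_of_mem hs hx' with hp | hp
  · have h1 : v <+: (t ++ s).drop s.length ++ v := by
      have := hp.drop s.length
      rwa [List.drop_left, List.drop_append_of_le_length (by simp)] at this
    refine h (i :: (t ++ s).take s.length) ((t ++ s).drop s.length) (by simp) ?_ (by simp) h1
    rw [← List.length_pos_iff]
    simpa using htl
  · have := hp.length_le
    simp only [List.length_append] at this
    omega

lemma volume_suffixUnion {u v : List (Fin p)} (hv : v ≠ []) (h : NoEarly u v) :
    volume (S.suffixUnion u v) = ENNReal.ofReal (S.tot u v) := by
  have hnn : ∀ u : List (Fin p), 0 ≤ S.tot u v := fun u => by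
    induction u with
    | nil => exact le_rfl
    | cons i u ih => exact add_nonneg Metric.diam_nonneg ih
  induction u with
  | nil => simp [suffixUnion, tot]
  | cons i u ih =>
    have huv : u ++ v ≠ [] := by simp [hv]
    rw [suffixUnion, tot, measure_union' (h.disjoint S) (S.measurableSet_cyl huv), ih h.of_cons,
      S.volume_cyl huv, ENNReal.ofReal_add (S.len_pos huv).le (hnn u)]

lemma tot_le {u v : List (Fin p)} (hv : v ≠ []) (h : NoEarly u v) {U : Set ℝ} {ℓ : ℝ}
    (hℓ : 0 ≤ ℓ) (hU : volume U ≤ ENNReal.ofReal ℓ)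
    (hsub : ∀ t s, t ≠ [] → u = t ++ s → S.cyl (s ++ v) ⊆ U) : S.tot u v ≤ ℓ := by
  rw [← ENNReal.ofReal_le_ofReal_iff hℓ, ← S.volume_suffixUnion hv h]
  refine (measure_mono fun x hx => ?_).trans hU
  obtain ⟨t, s, ht, hu, hx⟩ := S.mem_suffixUnion.1 hx
  exact hsub t s ht hu hx

/-- The length of the ambient interval. -/
noncomputable def lenI : ℝ := Metric.diam S.I

lemma volume_I : volume S.I = ENNReal.ofReal S.lenI := by
  obtain ⟨a, b, hab, h⟩ := S.hI
  rw [lenI, h, Real.volume_Icc, Real.diam_Icc hab.le]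

lemma cyl_subset_I (w : List (Fin p)) : S.cyl w ⊆ S.I := by
  cases w with
  | nil => exact subset_rfl
  | cons i w => exact (S.cyl_cons_subset_Isub i w).trans (S.hsubI i)

lemma tot_le_lenI {u v : List (Fin p)} (hv : v ≠ []) (h : NoEarly u v) : S.tot u v ≤ S.lenI :=
  S.tot_le hv h Metric.diam_nonneg S.volume_I.le fun _ _ _ _ => S.cyl_subset_I _

end ExpansiveMarkovSystem

/-- `A` has definite gaps at arbitrarily small scales around `x`. -/
def IsPorousAt (A : Set ℝ) (x : ℝ) : Prop :=
  ∃ c : ℝ, 0 < c ∧ ∀ ε : ℝ, 0 < ε → ∃ s t r : ℝ, 0 < r ∧ r < ε ∧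
    Set.uIcc s t ⊆ Metric.closedBall x r ∧ Disjoint (Set.uIcc s t) A ∧ c * r ≤ |s - t|

/-- The points of a set at which the set is porous form a null set. -/
lemma volume_isPorousAt (A : Set ℝ) : volume {x ∈ A | IsPorousAt A x} = 0 := by
  have hae := IsUnifLocDoublingMeasure.ae_tendsto_measure_inter_div (volume : Measure ℝ) A 1
  have hnull : volume ({x | IsPorousAt A x} ∩ A) = 0 := by
    refine le_antisymm ((Measure.le_restrict_apply _ _).trans (le_of_eq ?_)) zero_le
    refine measure_mono_null ?_ (ae_iff.1 hae)
    intro x hx hlim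
    obtain ⟨c, hc, hx⟩ := hx
    choose s t r hr0 hr hsub hdisj hcr using fun n : ℕ =>
      hx (1 / ((n : ℝ) + 1)) (by positivity)
    have hrlim : Tendsto r atTop (nhdsWithin 0 (Set.Ioi 0)) := by
      refine tendsto_nhdsWithin_iff.2 ⟨?_, Eventually.of_forall hr0⟩
      exact squeeze_zero (fun n => (hr0 n).le) (fun n => (hr n).le)
        tendsto_one_div_add_atTop_nhds_zero_nat
    have h1 := hlim (fun _ => x) r hrlim
      (Eventually.of_forall fun n => by simpa using (hr0 n).le)
    have hle : ∀ n, volume (A ∩ Metric.closedBall x (r n)) / volume (Metric.closedBall x (r n)) ≤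
        ENNReal.ofReal (1 - c / 2) := by
      intro n
      have h2 : volume (A ∩ Metric.closedBall x (r n)) ≤
          ENNReal.ofReal (2 * r n) - ENNReal.ofReal (c * r n) := by
        calc _ ≤ volume (Metric.closedBall x (r n) \ Set.uIcc (s n) (t n)) :=
              measure_mono fun z hz => ⟨hz.2, fun hz' => Set.disjoint_left.1 (hdisj n) hz' hz.1⟩
          _ = volume (Metric.closedBall x (r n)) - volume (Set.uIcc (s n) (t n)) :=
              measure_sdiff (hsub n) measurableSet_uIcc.nullMeasurableSet (by simp)
          _ ≤ _ := by
              rw [Real.volume_closedBall, Real.volume_interval, abs_sub_comm]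
              exact tsub_le_tsub_left (ENNReal.ofReal_le_ofReal (hcr n)) _
      rw [Real.volume_closedBall]
      refine ENNReal.div_le_of_le_mul (h2.trans ?_)
      rw [← ENNReal.ofReal_sub _ (mul_pos hc (hr0 n)).le,
        ← ENNReal.ofReal_mul' (by linarith [hr0 n])]
      exact ENNReal.ofReal_le_ofReal (le_of_eq (by ring))
    have h3 : (1 : ENNReal) ≤ ENNReal.ofReal (1 - c / 2) := le_of_tendsto' h1 hle
    rw [ENNReal.one_le_ofReal] at h3
    linarith
  rwa [Set.inter_comm] at hnull

section Words

variable {α : Type*}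

/-- The word of length `m` read in `ω` from position `n`. -/
def seg (ω : ℕ → α) (n m : ℕ) : List α := (List.range m).map fun k => ω (n + k)

@[simp] lemma length_seg (ω : ℕ → α) (n m : ℕ) : (seg ω n m).length = m := by simp [seg]

lemma seg_add (ω : ℕ → α) (n m k : ℕ) : seg ω n (m + k) = seg ω n m ++ seg ω (n + m) k := by
  simp [seg, List.range_add, Function.comp_def, add_assoc]

lemma wordOf_eq_seg {p : ℕ} (ω : ℕ → Fin p) (n : ℕ) : wordOf ω n = seg ω 0 n := by
  simp [wordOf, seg]

lemma seg_getElem (ω : ℕ → α) (n m k : ℕ) (h : k < (seg ω n m).length) :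
    (seg ω n m)[k] = ω (n + k) := by simp [seg]

/-- The word `w` occurs in `ω` at position `n`. -/
def Occ (ω : ℕ → α) (n : ℕ) (w : List α) : Prop := seg ω n w.length = w

lemma occ_seg (ω : ℕ → α) (n m : ℕ) : Occ ω n (seg ω n m) := by simp [Occ]

lemma occ_append {ω : ℕ → α} {n : ℕ} {u v : List α} :
    Occ ω n (u ++ v) ↔ Occ ω n u ∧ Occ ω (n + u.length) v := by
  rw [Occ, List.length_append, seg_add]
  exact ⟨fun h => List.append_inj h (by simp), fun h => congrArg₂ _ h.1 h.2⟩

lemma Occ.of_prefix {ω : ℕ → α} {n : ℕ} {v w : List α} (h : Occ ω n w) (hv : v <+: w) :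
    Occ ω n v := by
  obtain ⟨t, rfl⟩ := hv
  exact (occ_append.1 h).1

lemma Occ.prefix_of_length_le {ω : ℕ → α} {n : ℕ} {v w : List α} (hv : Occ ω n v)
    (hw : Occ ω n w) (h : v.length ≤ w.length) : v <+: w := by
  obtain ⟨k, hk⟩ := Nat.exists_eq_add_of_le h
  rw [← hv, ← hw, hk, seg_add]
  exact List.prefix_append _ _

/-- The words occurring infinitely often in `ω`. -/
def recWords (ω : ℕ → α) : Set (List α) := {w | ∃ᶠ n in atTop, Occ ω n w}

/-- Every factor of a word in the set is in the set. -/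
def FactorClosed (L : Set (List α)) : Prop := ∀ u v w, u ++ v ++ w ∈ L → v ∈ L

lemma FactorClosed.of_prefix {L : Set (List α)} (hL : FactorClosed L) {v w : List α} (hw : w ∈ L)
    (h : v <+: w) : v ∈ L := by
  obtain ⟨t, rfl⟩ := h
  exact hL [] v t (by simpa using hw)

lemma FactorClosed.of_suffix {L : Set (List α)} (hL : FactorClosed L) {u v : List α}
    (h : u ++ v ∈ L) : v ∈ L := hL u v [] (by simpa using h)

lemma factorClosed_recWords (ω : ℕ → α) : FactorClosed (recWords ω) := by
  intro u v w h
  simp only [recWords, Set.mem_ofPred_eq, frequently_atTop] at h ⊢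
  intro N
  obtain ⟨n, hn, h⟩ := h N
  exact ⟨n + u.length, by omega, (occ_append.1 (occ_append.1 h).1).2⟩

lemma frequently_exists_finite {β : Type*} {T : Set β} (hT : T.Finite) {P : β → ℕ → Prop}
    (h : ∃ᶠ n in atTop, ∃ a ∈ T, P a n) : ∃ a ∈ T, ∃ᶠ n in atTop, P a n := by
  by_contra hcon
  push Not at hcon
  have h2 : ∀ᶠ n in atTop, ∀ a ∈ T, ¬ P a n :=
    (eventually_all_finite hT).2 hcon
  exact h (h2.mono fun n hn => by simpa using hn)

lemma exists_frequently_occ [Finite α] (ω : ℕ → α) (m : ℕ) {P : ℕ → Prop}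
    (h : ∃ᶠ n in atTop, P n) : ∃ w : List α, w.length = m ∧ ∃ᶠ n in atTop, P n ∧ Occ ω n w :=
  frequently_exists_finite (T := {w : List α | w.length = m}) (List.finite_length_eq α m)
    (P := fun w n => P n ∧ Occ ω n w)
    (h.mono fun n hn => ⟨seg ω n m, by simp, hn, occ_seg ω n m⟩)

lemma exists_mem_recWords [Finite α] (ω : ℕ → α) (m : ℕ) : ∃ w ∈ recWords ω, w.length = m := by
  obtain ⟨w, hw, h⟩ := exists_frequently_occ ω m (P := fun _ => True)
    ((frequently_true_iff_neBot _).2 inferInstance)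
  exact ⟨w, h.mono fun _ h => h.2, hw⟩

/-- The sequence is periodic from some point on. -/
def EventuallyPeriodic (ω : ℕ → α) : Prop :=
  ∃ n r : ℕ, 1 ≤ r ∧ ∀ k, n ≤ k → ω (k + r) = ω k

lemma countable_eventuallyPeriodic [Finite α] :
    {ω : ℕ → α | EventuallyPeriodic ω}.Countable := by
  have hsub : {ω : ℕ → α | EventuallyPeriodic ω} ⊆ ⋃ q : ℕ × ℕ × List α,
      {ω | 1 ≤ q.2.1 ∧ (∀ k, q.1 ≤ k → ω (k + q.2.1) = ω k) ∧ seg ω 0 (q.1 + q.2.1) = q.2.2} := by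
    rintro ω ⟨n, r, hr, h⟩
    exact Set.mem_iUnion.2 ⟨(n, r, seg ω 0 (n + r)), hr, h, rfl⟩
  have : Countable α := Finite.to_countable
  refine (Set.countable_iUnion fun q => Set.Subsingleton.countable ?_).mono hsub
  rintro ω ⟨hr, h, hw⟩ ω' ⟨-, h', hw'⟩
  obtain ⟨n, r, w⟩ := q
  dsimp only at *
  funext k
  induction k using Nat.strong_induction_on with
  | _ k ih =>
    rcases lt_or_ge k (n + r) with hk | hk
    · have h1 := List.getElem_of_eq (hw.trans hw'.symm) (i := k) (by simpa using hk)
      simpa [seg_getElem] using h1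
    · obtain ⟨j, rfl⟩ : ∃ j, k = j + r := ⟨k - r, by omega⟩
      rw [h j (by omega), h' j (by omega), ih j (by omega)]

/-- The word `w` has period `r`. -/
def HasPeriod (w : List α) (r : ℕ) : Prop := ∀ i, i + r < w.length → w[i + r]? = w[i]?

lemma hasPeriod_of_prefix_append {a w : List α} (h : w <+: a ++ w) : HasPeriod w a.length := by
  intro i hi
  have h1 := List.prefix_iff_getElem?.1 h (i + a.length) hi
  rw [List.getElem?_append_right (by omega), Nat.add_sub_cancel] at h1
  rw [h1, List.getElem?_eq_getElem hi]

end Words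

namespace ExpansiveMarkovSystem

variable {p : ℕ} (S : ExpansiveMarkovSystem p)

/-- The points of the limit set without forbidden words whose coding is `ω`. -/
def HasCode (x : ℝ) (ω : ℕ → Fin p) : Prop := ∀ n, x ∈ S.cyl (wordOf ω n)

/-- The limit set of the system without forbidden words. -/
def fullSet : Set ℝ := {x | ∃ ω, S.HasCode x ω}

lemma limitSet_subset_fullSet : S.limitSet ⊆ S.fullSet := fun _ ⟨ω, _, h⟩ => ⟨ω, h⟩

lemma HasCode.mem_cyl {x : ℝ} {ω : ℕ → Fin p} (h : S.HasCode x ω) {w : List (Fin p)}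
    (hw : Occ ω 0 w) : x ∈ S.cyl w := by
  have := h w.length
  rwa [wordOf_eq_seg, hw] at this

lemma HasCode.occ {x : ℝ} {ω : ℕ → Fin p} (h : S.HasCode x ω) {w : List (Fin p)}
    (hw : x ∈ S.cyl w) : Occ ω 0 w := by
  have h1 := h w.length
  rw [wordOf_eq_seg] at h1
  rcases S.prefix_or_prefix_of_mem h1 hw with h2 | h2
  · exact h2.eq_of_length (by simp)
  · exact (h2.eq_of_length (by simp)).symm

lemma subsingleton_hasCode (ω : ℕ → Fin p) : {x | S.HasCode x ω}.Subsingleton := by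
  intro x hx y hy
  by_contra hne
  obtain ⟨N, hN⟩ := S.hgen |x - y| (abs_pos.2 (sub_ne_zero.2 hne))
  have hw : wordOf ω (N + 1) ≠ [] := by simp [wordOf]
  have := hN (wordOf ω (N + 1)) (by simp [wordOf])
  exact absurd (S.abs_sub_le_len hw (hx _) (hy _)) (not_le.2 this)

lemma volume_eventuallyPeriodic :
    volume {x | ∃ ω, EventuallyPeriodic ω ∧ S.HasCode x ω} = 0 := by
  refine Set.Countable.measure_zero ?_ _
  have : {x | ∃ ω, EventuallyPeriodic ω ∧ S.HasCode x ω} =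
      ⋃ ω ∈ {ω : ℕ → Fin p | EventuallyPeriodic ω}, {x | S.HasCode x ω} := by
    ext x
    simp
  rw [this]
  exact countable_eventuallyPeriodic.biUnion fun ω _ => (S.subsingleton_hasCode ω).countable

lemma len_le_lenI {w : List (Fin p)} (hw : w ≠ []) : S.len w ≤ S.lenI := by
  obtain ⟨x, hx, y, hy, h⟩ := S.exists_abs_sub_eq_len hw
  rw [← h, ← Real.dist_eq]
  obtain ⟨a, b, -, hI⟩ := S.hI
  exact Metric.dist_le_diam_of_mem (hI ▸ isBounded_Icc a b) (S.cyl_subset_I w hx)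
    (S.cyl_subset_I w hy)

lemma lenI_nonneg : 0 ≤ S.lenI := Metric.diam_nonneg

lemma tot_le_length_mul (u : List (Fin p)) {v : List (Fin p)} (hv : v ≠ []) :
    S.tot u v ≤ u.length * S.lenI := by
  induction u with
  | nil => simp [tot]
  | cons i u ih =>
    have := S.len_le_lenI (w := u ++ v) (by simp [hv])
    rw [tot, List.length_cons]
    push_cast
    linarith

/-- A bound for the distortion of first returns. -/
noncomputable def distK : ℝ := Real.exp (S.distC * S.lenI)

lemma distK_pos : 0 < S.distK := Real.exp_pos _

lemma exp_tot_le {u v : List (Fin p)} {ℓ : ℝ} (h : S.tot u v ≤ ℓ) :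
    Real.exp (S.distC * S.tot u v) ≤ Real.exp (S.distC * ℓ) :=
  Real.exp_le_exp.2 (mul_le_mul_of_nonneg_left h S.distC_pos.le)

/-- The word `a` leads from an occurrence of `v` to the next one. -/
structure IsReturn (a v : List (Fin p)) : Prop where
  ne_nil : a ≠ []
  prefix_append : v <+: a ++ v
  noEarly : NoEarly a v

/-- The map of the word `a` is a definite contraction on the cylinder of `v`. -/
def Fast (a v : List (Fin p)) : Prop :=
  ∀ x ∈ S.cyl v, ∀ y ∈ S.cyl v, |S.wordMap a x - S.wordMap a y| ≤ 9 / 10 * |x - y|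

lemma fast_of_len_le {a v : List (Fin p)} (hv : v ≠ []) (ha : NoEarly a v)
    (h : S.distK * S.len (a ++ v) ≤ 9 / 10 * S.len v) : S.Fast a v := by
  intro x hx y hy
  obtain ⟨x', hx', y', hy', hxy'⟩ := S.exists_abs_sub_eq_len hv
  have h1 := S.distortion a hv hx hy hx' hy'
  have h2 := S.exp_tot_le (S.tot_le_lenI hv ha)
  have h3 := S.abs_sub_le_len (w := a ++ v) (by simp [hv]) (S.wordMap_mem_cyl a hv hx')
    (S.wordMap_mem_cyl a hv hy')
  have hlen := S.len_pos hv
  rw [hxy'] at h1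
  refine le_of_mul_le_mul_right ?_ hlen
  calc _ ≤ _ := h1
    _ ≤ S.distK * S.len (a ++ v) * |x - y| := by
      gcongr
      · exact S.distK_pos.le
      · exact h2
    _ ≤ 9 / 10 * S.len v * |x - y| := by gcongr
    _ = _ := by ring

lemma le_of_not_fast {a v : List (Fin p)} (hv : v ≠ []) (h : ¬ S.Fast a v) {ℓ : ℝ}
    (hℓ : S.tot a v ≤ ℓ) {x y : ℝ} (hx : x ∈ S.cyl v) (hy : y ∈ S.cyl v) :
    9 / 10 * |x - y| ≤ Real.exp (S.distC * ℓ) * |S.wordMap a x - S.wordMap a y| := by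
  simp only [Fast, not_forall, not_le] at h
  obtain ⟨x', hx', y', hy', h⟩ := h
  have h1 := S.distortion a hv hx' hy' hx hy
  have h2 := S.exp_tot_le hℓ
  have hpos : 0 < |x' - y'| := by
    rw [abs_pos, sub_ne_zero]
    rintro rfl
    simp at h
  refine le_of_mul_le_mul_right ?_ hpos
  calc _ = (9 / 10 * |x' - y'|) * |x - y| := by ring
    _ ≤ |S.wordMap a x' - S.wordMap a y'| * |x - y| := by gcongr
    _ ≤ _ := h1
    _ ≤ _ := by gcongr

lemma len_le_of_not_fast {a v w : List (Fin p)} (hv : v ≠ []) (h : ¬ S.Fast a v) {ℓ : ℝ}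
    (hℓ : S.tot a v ≤ ℓ) (hvw : v <+: w) :
    9 / 10 * S.len w ≤ Real.exp (S.distC * ℓ) * S.len (a ++ w) := by
  have hw : w ≠ [] := by rintro rfl; exact hv (List.prefix_nil.1 hvw)
  obtain ⟨x, hx, y, hy, hxy⟩ := S.exists_abs_sub_eq_len hw
  have h1 := S.le_of_not_fast hv h hℓ (S.cyl_mono hv hvw hx) (S.cyl_mono hv hvw hy)
  rw [hxy] at h1
  refine h1.trans ?_
  gcongr
  exact S.abs_sub_le_len (by simp [hw]) (S.wordMap_mem_cyl a hw hx) (S.wordMap_mem_cyl a hw hy)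

/-- Concatenations of fast returns to `v`. -/
inductive FastChain (v : List (Fin p)) : List (Fin p) → Prop
  | nil : FastChain v []
  | append {a b : List (Fin p)} (ha : IsReturn a v) (hf : S.Fast a v) (hb : FastChain v b) :
      FastChain v (a ++ b)

lemma tot_append_mul_le {a v w : List (Fin p)} (hv : v ≠ []) (ha : NoEarly a v)
    (hvw : v <+: w) : S.tot a w * S.len v ≤ S.distK * S.tot a v * S.len w := by
  induction a with
  | nil => simp [tot]
  | cons i a ih =>
    have h1 := S.len_append_le a hv hvw
    have h2 := S.exp_tot_le (S.tot_le_lenI hv ha.of_cons)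
    have h3 : S.len (a ++ w) * S.len v ≤ S.distK * S.len (a ++ v) * S.len w := by
      refine h1.trans ?_
      have : 0 ≤ S.len (a ++ v) := Metric.diam_nonneg
      have : 0 ≤ S.len w := Metric.diam_nonneg
      gcongr
      exact h2
    have := ih ha.of_cons
    simp only [tot]
    linarith

lemma FastChain.prefix_append {v b : List (Fin p)} (h : S.FastChain v b) : v <+: b ++ v := by
  induction h with
  | nil => simp
  | @append a b ha _ _ ih =>
    rw [List.append_assoc]
    exact ha.prefix_append.trans ((List.prefix_append_right_inj a).2 ih)

lemma FastChain.tot_mul_le {v b : List (Fin p)} (hv : v ≠ []) (h : S.FastChain v b) :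
    S.tot b v * S.len v ≤ 10 * (S.distK * S.lenI) * (S.len v - S.len (b ++ v)) := by
  induction h with
  | nil => simp [tot]
  | @append a b ha hf hb ih =>
    have hpre := hb.prefix_append
    have hbv : b ++ v ≠ [] := by simp [hv]
    have h1 := S.tot_append_mul_le hv ha.noEarly hpre
    have h2 := S.tot_le_lenI hv ha.noEarly
    have h3 : S.len (a ++ (b ++ v)) ≤ 9 / 10 * S.len (b ++ v) := by
      obtain ⟨x, hx, y, hy, hxy⟩ := S.exists_abs_sub_eq_len (w := a ++ (b ++ v)) (by simp [hv])
      rw [S.cyl_append a hbv] at hx hy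
      obtain ⟨x, hx, rfl⟩ := hx
      obtain ⟨y, hy, rfl⟩ := hy
      rw [← hxy]
      refine (hf x (S.cyl_mono hv hpre hx) y (S.cyl_mono hv hpre hy)).trans ?_
      gcongr
      exact S.abs_sub_le_len hbv hx hy
    have h4 : S.distK * S.tot a v * S.len (b ++ v) ≤ S.distK * S.lenI * S.len (b ++ v) := by
      have := S.distK_pos
      have := S.len_pos hbv
      gcongr
    have h5 : 0 ≤ S.distK * S.lenI := mul_nonneg S.distK_pos.le S.lenI_nonneg
    have h6 := mul_le_mul_of_nonneg_left h3 h5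
    rw [S.tot_append, List.append_assoc]
    linarith

lemma FastChain.tot_le {v b : List (Fin p)} (hv : v ≠ []) (h : S.FastChain v b) :
    S.tot b v ≤ 10 * (S.distK * S.lenI) := by
  have h1 := h.tot_mul_le S hv
  have h2 := S.len_pos hv
  have h3 := S.len_pos (w := b ++ v) (by simp [hv])
  have h5 : 0 ≤ S.distK * S.lenI := mul_nonneg S.distK_pos.le S.lenI_nonneg
  refine le_of_mul_le_mul_right (h1.trans ?_) h2
  gcongr
  linarith

/-- Each interval contains a gap of the limit set at its left end. -/
lemma exists_gap (i : Fin p) : ∃ α γ : ℝ, α < γ ∧ Set.Icc α γ ⊆ S.Isub i ∧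
    Disjoint (Set.Icc α γ) (S.g i '' S.dom) := by
  obtain ⟨a, b, hab, h⟩ := S.hIsub i
  have hdom : IsCompact S.dom := isCompact_iUnion fun j => by
    obtain ⟨a, b, -, h⟩ := S.hIsub j
    rw [h]
    exact isCompact_Icc
  have hcl : IsClosed (S.g i '' S.dom) :=
    (hdom.image_of_continuousOn (S.continuousOn_g i)).isClosed
  have ha : a ∈ (S.g i '' S.dom)ᶜ := fun ha => by
    have := S.hg_range i ha
    rw [h, interior_Icc] at this
    exact lt_irrefl a this.1
  obtain ⟨ε, hε, hsub⟩ := Metric.isOpen_iff.1 hcl.isOpen_compl a ha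
  refine ⟨a, min b (a + ε / 2), lt_min hab (by linarith), ?_, ?_⟩
  · rw [h]
    exact Set.Icc_subset_Icc_right (min_le_left _ _)
  · refine Set.disjoint_left.2 fun x hx => hsub ?_
    have := hx.2.trans (min_le_right _ _)
    rw [Metric.mem_ball, Real.dist_eq, abs_lt]
    constructor <;> linarith [hx.1]

lemma disjoint_image_gap {i : Fin p} {A : Set ℝ} (hA : A ⊆ S.Isub i)
    (hdisj : Disjoint A (S.g i '' S.dom)) (W : List (Fin p)) :
    Disjoint (S.wordMap W '' A) S.fullSet := by
  rw [Set.disjoint_left]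
  rintro _ ⟨e, he, rfl⟩ ⟨ω, hω⟩
  have h1 : S.wordMap W e ∈ S.cyl (W ++ [i]) := by
    rw [S.cyl_append W (by simp)]
    exact Set.mem_image_of_mem _ (hA he)
  have h2 := hω.occ S h1
  have h3 : Occ ω 0 (W ++ [i, ω (W.length + 1)]) := by
    have : Occ ω 0 ((W ++ [i]) ++ [ω (W.length + 1)]) :=
      occ_append.2 ⟨h2, by simp [Occ, seg]⟩
    simpa using this
  have h4 := hω.mem_cyl S h3
  rw [S.cyl_append W (by simp)] at h4
  obtain ⟨e', he', h5⟩ := h4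
  obtain rfl := S.injOn_wordMap W (S.cyl_subset_dom (by simp) he')
    (S.Isub_subset_dom i (hA he)) h5
  rw [S.cyl_cons i (by simp)] at he'
  exact Set.disjoint_left.1 hdisj he (Set.image_mono (S.cyl_subset_dom (by simp)) he')

lemma isPorousAt_of_tot_le {x : ℝ} {v : List (Fin p)} (hv : v ≠ []) {T : ℝ}
    (h : ∀ N : ℕ, ∃ u, N ≤ u.length ∧ x ∈ S.cyl (u ++ v) ∧ S.tot u v ≤ T) :
    IsPorousAt S.fullSet x := by
  obtain ⟨V, i, rfl⟩ : ∃ V i, v = V ++ [i] := ⟨_, _, (List.dropLast_append_getLast hv).symm⟩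
  obtain ⟨α, γ, hαγ, hgap, hdisj⟩ := S.exists_gap i
  have hα : α ∈ Set.Icc α γ := ⟨le_rfl, hαγ.le⟩
  have hγ : γ ∈ Set.Icc α γ := ⟨hαγ.le, le_rfl⟩
  have hdom : Set.Icc α γ ⊆ S.dom := hgap.trans (S.Isub_subset_dom i)
  have hmem : ∀ e ∈ Set.Icc α γ, S.wordMap V e ∈ S.cyl (V ++ [i]) := fun e he =>
    S.wordMap_mem_cyl V (by simp) (hgap he)
  have hne : 0 < |S.wordMap V α - S.wordMap V γ| := by
    rw [abs_pos, sub_ne_zero]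
    exact fun h => hαγ.ne (S.injOn_wordMap V (hdom hα) (hdom hγ) h)
  have hlen := S.len_pos hv
  refine ⟨|S.wordMap V α - S.wordMap V γ| / (Real.exp (S.distC * T) * S.len (V ++ [i])),
    by positivity, fun ε hε => ?_⟩
  obtain ⟨N, hN⟩ := S.hgen ε hε
  obtain ⟨u, hu, hx, hT⟩ := h N
  have huv : u ++ (V ++ [i]) ≠ [] := by simp
  have hsub : Set.uIcc (S.wordMap u (S.wordMap V α)) (S.wordMap u (S.wordMap V γ)) ⊆
      S.wordMap (u ++ V) '' Set.Icc α γ := by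
    have : (S.wordMap (u ++ V) '' Set.Icc α γ).OrdConnected :=
      (isPreconnected_Icc.image _ ((S.continuousOn_wordMap _).mono hdom)).ordConnected
    exact this.uIcc_subset ⟨α, hα, S.wordMap_append u V α⟩ ⟨γ, hγ, S.wordMap_append u V γ⟩
  refine ⟨S.wordMap u (S.wordMap V α), S.wordMap u (S.wordMap V γ), S.len (u ++ (V ++ [i])),
    S.len_pos huv, hN _ (by simp; omega), fun y hy => ?_,
    (S.disjoint_image_gap hgap hdisj (u ++ V)).mono_left hsub, ?_⟩
  · obtain ⟨e, he, rfl⟩ := hsub hy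
    rw [Metric.mem_closedBall, Real.dist_eq]
    refine S.abs_sub_le_len huv ?_ hx
    rw [S.wordMap_append]
    exact S.wordMap_mem_cyl u hv (hmem e he)
  · obtain ⟨x', hx', y', hy', hxy'⟩ := S.exists_abs_sub_eq_len huv
    rw [S.cyl_append u hv] at hx' hy'
    obtain ⟨x', hx', rfl⟩ := hx'
    obtain ⟨y', hy', rfl⟩ := hy'
    have h1 := S.distortion u hv hx' hy' (hmem α hα) (hmem γ hγ)
    rw [hxy'] at h1
    rw [div_mul_eq_mul_div, div_le_iff₀ (by positivity), mul_comm _ (S.len (u ++ _))]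
    refine h1.trans ?_
    have h2 := S.exp_tot_le hT
    have h3 := S.abs_sub_le_len hv hx' hy'
    calc _ ≤ Real.exp (S.distC * T) *
          |S.wordMap u (S.wordMap V α) - S.wordMap u (S.wordMap V γ)| * S.len (V ++ [i]) := by
          gcongr
      _ = _ := by ring

end ExpansiveMarkovSystem

lemma noEarly_seg {α : Type*} {ω : ℕ → α} {n k : ℕ} {v : List α} (hv : Occ ω (n + k) v)
    (h : ∀ j, 0 < j → j < k → ¬ Occ ω (n + j) v) {t s : List α} (ht : t ≠ []) (hs : s ≠ [])
    (hts : seg ω n k = t ++ s) : ¬ v <+: s ++ v := by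
  intro hpre
  have hlen : k = t.length + s.length := by simpa using congrArg List.length hts
  have h1 : Occ ω n (t ++ (s ++ v)) := by
    rw [← List.append_assoc, ← hts]
    exact occ_append.2 ⟨occ_seg ω n k, by simpa using hv⟩
  have := List.length_pos_iff.2 ht
  have := List.length_pos_iff.2 hs
  exact h t.length (by omega) (by omega) ((occ_append.1 h1).2.of_prefix hpre)

namespace ExpansiveMarkovSystem

variable {p : ℕ} (S : ExpansiveMarkovSystem p)

lemma exists_isReturn {ω : ℕ → Fin p} {n m : ℕ} {v : List (Fin p)} (hn : Occ ω n v)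
    (hm : Occ ω m v) (hnm : n < m) :
    ∃ k, 0 < k ∧ n + k ≤ m ∧ IsReturn (seg ω n k) v ∧ Occ ω (n + k) v := by
  have hex : ∃ k, 0 < k ∧ Occ ω (n + k) v :=
    ⟨m - n, by omega, by rwa [Nat.add_sub_cancel' hnm.le]⟩
  obtain ⟨hk0, hk⟩ := Nat.find_spec hex
  have hmin : ∀ j, 0 < j → j < Nat.find hex → ¬ Occ ω (n + j) v :=
    fun j hj hlt hocc => Nat.find_min hex hlt ⟨hj, hocc⟩
  refine ⟨Nat.find hex, hk0, ?_, ⟨?_, ?_, ?_⟩, hk⟩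
  · have : Nat.find hex ≤ m - n :=
      Nat.find_min' hex ⟨by omega, by rwa [Nat.add_sub_cancel' hnm.le]⟩
    omega
  · rw [ne_eq, ← List.length_eq_zero_iff, length_seg]
    exact hk0.ne'
  · exact hn.prefix_of_length_le (occ_append.2 ⟨occ_seg ω n _, by simpa using hk⟩) (by simp)
  · exact fun t s ht hs hts => noEarly_seg hk hmin ht hs hts

/-- The points to which the renormalization argument applies. -/
structure IsTypical (x : ℝ) (ω : ℕ → Fin p) : Prop where
  hasCode : S.HasCode x ω
  not_porous : ¬ IsPorousAt S.fullSet x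
  not_periodic : ¬ EventuallyPeriodic ω

lemma fastChain_seg {ω : ℕ → Fin p} {v : List (Fin p)} {n₀ : ℕ}
    (hfast : ∀ n k, n₀ ≤ n → Occ ω n v → IsReturn (seg ω n k) v → Occ ω (n + k) v →
      S.Fast (seg ω n k) v) (d : ℕ) :
    ∀ n, n₀ ≤ n → Occ ω n v → Occ ω (n + d) v → S.FastChain v (seg ω n d) := by
  induction d using Nat.strong_induction_on with
  | _ d ih =>
    intro n hn hocc hd
    rcases Nat.eq_zero_or_pos d with rfl | hpos
    · exact FastChain.nil
    · obtain ⟨k, hk0, hk, hret, hock⟩ := exists_isReturn hocc hd (by omega)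
      obtain ⟨e, rfl⟩ : ∃ e, d = k + e := ⟨d - k, by omega⟩
      rw [seg_add]
      exact FastChain.append hret (hfast n k hn hocc hret hock)
        (ih e (by omega) (n + k) (by omega) hock (by rwa [add_assoc]))

lemma IsTypical.exists_slow {x : ℝ} {ω : ℕ → Fin p} (h : S.IsTypical x ω) {v : List (Fin p)}
    (hv : v ≠ []) (hrec : v ∈ recWords ω) :
    ∃ a, IsReturn a v ∧ ¬ S.Fast a v ∧ a ++ v ∈ recWords ω := by
  obtain ⟨N, hN⟩ := S.hgen (9 / 10 * S.len v / S.distK)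
    (div_pos (mul_pos (by norm_num) (S.len_pos hv)) S.distK_pos)
  have hfreq : ∃ᶠ n in atTop, ∃ a ∈ {a : List (Fin p) | a.length ≤ N},
      (IsReturn a v ∧ ¬ S.Fast a v) ∧ Occ ω n (a ++ v) := by
    intro hcon
    obtain ⟨n₀, hn₀⟩ := eventually_atTop.1 hcon
    refine h.not_porous ?_
    obtain ⟨n₁, hn₁, hocc₁⟩ := (frequently_atTop.1 hrec) n₀
    have hfast : ∀ n k, n₀ ≤ n → Occ ω n v → IsReturn (seg ω n k) v → Occ ω (n + k) v →
        S.Fast (seg ω n k) v := by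
      intro n k hn _ hret hk
      by_contra hslow
      refine hn₀ n hn ⟨seg ω n k, ?_, ⟨hret, hslow⟩,
        occ_append.2 ⟨occ_seg ω n k, by simpa using hk⟩⟩
      by_contra hlen
      refine hslow (S.fast_of_len_le hv hret.noEarly ?_)
      have := hN (seg ω n k ++ v) (by
        simp only [Set.mem_ofPred_eq, length_seg, not_le, List.length_append] at hlen ⊢
        omega)
      rw [lt_div_iff₀ S.distK_pos, mul_comm] at this
      exact this.le
    refine S.isPorousAt_of_tot_le hv (T := n₁ * S.lenI + 10 * (S.distK * S.lenI)) fun M => ?_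
    obtain ⟨m, hm, hoccm⟩ := (frequently_atTop.1 hrec) (n₁ + M)
    obtain ⟨d, rfl⟩ : ∃ d, m = n₁ + d := ⟨m - n₁, by omega⟩
    have hchain := S.fastChain_seg hfast d n₁ hn₁ hocc₁ hoccm
    refine ⟨seg ω 0 n₁ ++ seg ω n₁ d, by simp; omega, h.hasCode.mem_cyl S ?_, ?_⟩
    · simp [occ_append, occ_seg, hoccm]
    · rw [S.tot_append]
      have h1 := S.tot_le_length_mul (seg ω 0 n₁) (v := seg ω n₁ d ++ v) (by simp [hv])
      rw [length_seg] at h1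
      exact add_le_add h1 (hchain.tot_le S hv)
  obtain ⟨a, -, ha⟩ := frequently_exists_finite (List.finite_length_le (Fin p) N) hfreq
  obtain ⟨-, ha', -⟩ := ha.exists
  exact ⟨a, ha'.1, ha'.2, ha.mono fun _ h => h.2⟩

end ExpansiveMarkovSystem

/-- A sequence with arbitrarily long recurrent words of period `r` which is not eventually periodic
has recurrent words whose period `r` breaks at the last letter. -/
lemma exists_break {α : Type*} [Finite α] {ω : ℕ → α} (hω : ¬ EventuallyPeriodic ω) {r : ℕ}
    (hr : 1 ≤ r) (h : ∀ N, ∃ w ∈ recWords ω, HasPeriod w r ∧ N ≤ w.length) {n : ℕ} (hn : r ≤ n) :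
    ∃ v ∈ recWords ω, v.length = n + 1 ∧ (∀ i, i + r < n → v[i + r]? = v[i]?) ∧
      v[n]? ≠ v[n - r]? := by
  have hfreq : ∃ᶠ k in atTop, (∀ i, k ≤ i → i + r < k + n → ω (i + r) = ω i) ∧
      ω (k + n) ≠ ω (k + n - r) := by
    rw [frequently_atTop]
    intro K
    obtain ⟨w, hw, hper, hlen⟩ := h n
    obtain ⟨k, hk, hocc⟩ := frequently_atTop.1 hw K
    have hex : ∃ j, k ≤ j ∧ ω (j + r) ≠ ω j := by
      by_contra hcon
      push Not at hcon
      exact hω ⟨k, r, hr, hcon⟩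
    obtain ⟨hj, hne⟩ := Nat.find_spec hex
    set j := Nat.find hex with hjdef
    have hmin : ∀ i, k ≤ i → i < j → ω (i + r) = ω i := fun i hi hlt => by
      by_contra hcon
      exact Nat.find_min hex hlt ⟨hi, hcon⟩
    have hletter : ∀ i, i < w.length → w[i]? = some (ω (k + i)) := fun i hi => by
      rw [← hocc, List.getElem?_eq_getElem (by simpa using hi), seg_getElem]
    have hjn : k + n ≤ j + r := by
      by_contra hcon
      refine hne ?_
      have h1 := hper (j - k) (by omega)
      rw [hletter _ (by omega), hletter _ (by omega), Option.some_inj] at h1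
      rwa [show k + (j - k + r) = j + r by omega, show k + (j - k) = j by omega] at h1
    refine ⟨j + r - n, by omega, fun i hi hlt => hmin i (by omega) (by omega), ?_⟩
    rwa [show j + r - n + n = j + r by omega, Nat.add_sub_cancel]
  obtain ⟨v, hv, hvfreq⟩ := exists_frequently_occ ω (n + 1) hfreq
  obtain ⟨k, ⟨hk1, hk2⟩, hocc⟩ := hvfreq.exists
  have hletter : ∀ i, i < n + 1 → v[i]? = some (ω (k + i)) := fun i hi => by
    rw [← hocc, List.getElem?_eq_getElem (by simp; omega), seg_getElem]
  refine ⟨v, hvfreq.mono fun _ h => h.2, hv, fun i hi => ?_, ?_⟩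
  · rw [hletter _ (by omega), hletter _ (by omega), ← add_assoc, hk1 _ (by omega) (by omega)]
  · rw [hletter _ (by omega), hletter _ (by omega), ← Nat.add_sub_assoc hn]
    exact fun h => hk2 (Option.some_inj.1 h)

namespace ExpansiveMarkovSystem

variable {p : ℕ} (S : ExpansiveMarkovSystem p)

lemma exists_forall_le_len (m : ℕ) :
    ∃ δ : ℝ, 0 < δ ∧ ∀ t : List (Fin p), t ≠ [] → t.length = m → δ ≤ S.len t := by
  have hfin : {t : List (Fin p) | t.length = m}.Finite := List.finite_length_eq _ _
  have hev : ∀ᶠ δ in nhdsWithin (0 : ℝ) (Set.Ioi 0),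
      ∀ t ∈ {t : List (Fin p) | t.length = m}, t ≠ [] → δ ≤ S.len t := by
    refine (eventually_all_finite hfin).2 fun t _ => ?_
    by_cases ht : t = []
    · simp [ht]
    · filter_upwards [nhdsWithin_le_nhds (eventually_le_nhds (S.len_pos ht))] with δ hδ _ using hδ
  obtain ⟨δ, hδ, hpos⟩ := (hev.and self_mem_nhdsWithin).exists
  exact ⟨δ, hpos, fun t ht hlen => hδ t hlen ht⟩

lemma IsTypical.exists_period_bound {x : ℝ} {ω : ℕ → Fin p} (h : S.IsTypical x ω) {r : ℕ}
    (hr : 1 ≤ r) : ∃ N, ∀ w ∈ recWords ω, HasPeriod w r → w.length < N := by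
  by_contra hcon
  push Not at hcon
  obtain ⟨δ, hδ, hδt⟩ := S.exists_forall_le_len (r + 1)
  obtain ⟨M, hM⟩ := S.hgen (9 / 10 * δ / (S.distK * S.distK))
    (div_pos (mul_pos (by norm_num) hδ) (mul_pos S.distK_pos S.distK_pos))
  obtain ⟨v, hv, hlen, hper, hbreak⟩ := exists_break h.not_periodic hr hcon
    (n := M + r) (by omega)
  have hv0 : v ≠ [] := by rw [← List.length_pos_iff]; omega
  obtain ⟨a, hret, hslow, -⟩ := h.exists_slow S hv0 hv
  have ha0 := List.length_pos_iff.2 hret.ne_nil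
  have haper := hasPeriod_of_prefix_append hret.prefix_append
  have hMa : M < a.length := by
    by_contra hle
    refine hbreak ?_
    have h1 := haper (M + r - a.length) (by omega)
    have h2 := haper (M - a.length) (by omega)
    have h3 := hper (M - a.length) (by omega)
    rw [show M + r - a.length + a.length = M + r by omega] at h1
    rw [show M - a.length + a.length = M by omega] at h2
    rw [show M - a.length + r = M + r - a.length by omega] at h3
    rw [h1, h3, Nat.add_sub_cancel, h2]
  obtain ⟨W, t, rfl, hW⟩ : ∃ W t, v = W ++ t ∧ W.length = M :=
    ⟨v.take M, v.drop M, (List.take_append_drop M v).symm, by simp; omega⟩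
  have htlen : t.length = r + 1 := by
    rw [List.length_append] at hlen
    omega
  have ht0 : t ≠ [] := by rw [← List.length_pos_iff]; omega
  obtain ⟨y, rfl⟩ : W <+: a := List.prefix_of_prefix_length_le
    ((List.prefix_append W t).trans hret.prefix_append) (List.prefix_append a _) (by omega)
  have hty : t <+: y ++ (W ++ t) := by
    have := hret.prefix_append
    rwa [List.append_assoc, List.prefix_append_right_inj] at this
  have hearly : NoEarly W t := by
    rintro t₁ s - hs rfl hpre
    have hs0 := List.length_pos_iff.2 hs
    rw [List.length_append] at hW
    have hi : ∀ i, i < r + 1 → (t₁ ++ s ++ t)[t₁.length + i]? = t[i]? := fun i hi => by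
      have h1 := List.prefix_iff_getElem?.1 hpre i (by omega)
      rw [List.append_assoc, List.getElem?_append_right (by omega), Nat.add_sub_cancel_left, h1,
        List.getElem?_eq_getElem]
    have hend : ∀ i, i < r + 1 → (t₁ ++ s ++ t)[M + i]? = t[i]? := fun i hi => by
      rw [List.getElem?_append_right (by simp; omega)]
      congr 1
      simp
      omega
    refine hbreak ?_
    rw [hend r (by omega), Nat.add_sub_cancel, ← hi r (by omega)]
    have h2 := hend 0 (by omega)
    rw [add_zero] at h2
    rw [h2, ← hi 0 (by omega), hper _ (by omega), add_zero]
  refine hslow (S.fast_of_len_le hv0 hret.noEarly ?_)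
  have h1 := S.len_append_le W ht0 hty
  have h2 := S.exp_tot_le (S.tot_le_lenI ht0 hearly)
  have h3 := hδt t ht0 htlen
  have h4 := hM (y ++ (W ++ t)) (by simp; omega)
  change S.len _ < _ at h4
  rw [lt_div_iff₀ (mul_pos S.distK_pos S.distK_pos)] at h4
  have hK := S.distK_pos
  have hWt := S.len_pos hv0
  have h5 : 0 ≤ S.len (y ++ (W ++ t)) := Metric.diam_nonneg
  rw [List.append_assoc]
  refine le_of_mul_le_mul_right ?_ (S.len_pos ht0)
  calc _ = S.distK * (S.len (W ++ (y ++ (W ++ t))) * S.len t) := by ring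
    _ ≤ S.distK * (S.distK * S.len (W ++ t) * S.len (y ++ (W ++ t))) := by
      refine mul_le_mul_of_nonneg_left (h1.trans ?_) hK.le
      gcongr
      exact h2
    _ = S.len (W ++ t) * (S.len (y ++ (W ++ t)) * (S.distK * S.distK)) := by ring
    _ ≤ S.len (W ++ t) * (9 / 10 * S.len t) := by
      refine mul_le_mul_of_nonneg_left (h4.le.trans ?_) hWt.le
      linarith
    _ = _ := by ring

/-- The union of the cylinders of the words of length `n` in `L`. -/
def levelSet (L : Set (List (Fin p))) (n : ℕ) : Set ℝ := ⋃ w ∈ {w ∈ L | w.length = n}, S.cyl w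

lemma mem_levelSet {L : Set (List (Fin p))} {n : ℕ} {x : ℝ} :
    x ∈ S.levelSet L n ↔ ∃ w ∈ L, w.length = n ∧ x ∈ S.cyl w := by
  simp [levelSet, and_assoc]

lemma tot_le_of_levelSet {L : Set (List (Fin p))} (hL : FactorClosed L) {u w : List (Fin p)}
    (hw : w ≠ []) (huw : u ++ w ∈ L) (h : NoEarly u w) {n : ℕ} (hn0 : 0 < n) (hn : n ≤ w.length)
    {ℓ : ℝ} (hℓ : 0 ≤ ℓ) (hvol : volume (S.levelSet L n) ≤ ENNReal.ofReal ℓ) : S.tot u w ≤ ℓ := by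
  refine S.tot_le hw h hℓ hvol ?_
  rintro t s - rfl x hx
  have hsw : s ++ w ∈ L := hL.of_suffix (u := t) (by simpa using huw)
  have hpre := List.take_prefix n (s ++ w)
  have hlen : ((s ++ w).take n).length = n := by simp; omega
  exact S.mem_levelSet.2 ⟨_, hL.of_prefix hsw hpre, hlen,
    S.cyl_mono (by rw [← List.length_pos_iff]; omega) hpre hx⟩

/-- Every recurrent word `v` of a typical point extends to a recurrent word `w` whose cylinder
contains a definitely large cylinder of a non-recurrent word. -/
lemma IsTypical.exists_forbidden {x : ℝ} {ω : ℕ → Fin p} (h : S.IsTypical x ω)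
    {v : List (Fin p)} (hv : v ≠ []) (hrec : v ∈ recWords ω) {ℓ : ℝ} (hℓ : 0 ≤ ℓ)
    (hvol : volume (S.levelSet (recWords ω) v.length) ≤ ENNReal.ofReal ℓ) :
    9 / 5 ≤ Real.exp (S.distC * ℓ) ∧ ∃ a w, w ∈ recWords ω ∧ v <+: w ∧ w <+: a ++ w ∧
      a ++ w ∉ recWords ω ∧ 9 / 10 * S.len w ≤ Real.exp (S.distC * ℓ) * S.len (a ++ w) := by
  have hfac := factorClosed_recWords ω
  obtain ⟨a, hret, hslow, hav⟩ := h.exists_slow S hv hrec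
  have ha0 := List.length_pos_iff.2 hret.ne_nil
  obtain ⟨N, hN⟩ := h.exists_period_bound S (r := a.length) ha0
  have hex : ∃ w ∈ {w | w ∈ recWords ω ∧ a ++ v <+: w ∧ w <+: a ++ w},
      ∀ w' ∈ {w | w ∈ recWords ω ∧ a ++ v <+: w ∧ w <+: a ++ w}, w'.length ≤ w.length := by
    have hfin : {w | w ∈ recWords ω ∧ a ++ v <+: w ∧ w <+: a ++ w}.Finite :=
      (List.finite_length_lt (Fin p) N).subset fun w hw =>
        hN w hw.1 (hasPeriod_of_prefix_append hw.2.2)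
    exact Set.exists_max_image _ _ hfin ⟨a ++ v, hav, List.prefix_rfl,
      (List.prefix_append_right_inj a).2 hret.prefix_append⟩
  obtain ⟨w, ⟨hw, havw, hwa⟩, hmax⟩ := hex
  have hvw : v <+: w := hret.prefix_append.trans havw
  have hw0 : w ≠ [] := by rintro rfl; exact hv (List.prefix_nil.1 hvw)
  have haw : a ++ w ∉ recWords ω := fun haw => by
    have := hmax (a ++ w) ⟨haw, havw.trans hwa, (List.prefix_append_right_inj a).2 hwa⟩
    rw [List.length_append] at this
    omega
  obtain ⟨u, huret, huslow, huw⟩ := h.exists_slow S hw0 hw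
  have hv0 := List.length_pos_iff.2 hv
  have hta := S.tot_le_of_levelSet hfac hv hav hret.noEarly hv0 le_rfl hℓ hvol
  have htu := S.tot_le_of_levelSet hfac hw0 huw huret.noEarly hv0 hvw.length_le hℓ hvol
  have h1 := S.len_le_of_not_fast hv hslow hta hvw
  have h2 := S.len_le_of_not_fast hw0 huslow htu List.prefix_rfl
  refine ⟨?_, a, w, hw, hvw, hwa, haw, h1⟩
  have hdisj : Disjoint (S.cyl (a ++ w)) (S.cyl (u ++ w)) := by
    refine S.disjoint_cyl (fun hp => haw (hfac.of_prefix huw hp)) fun hp => ?_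
    obtain ⟨y, rfl⟩ : u <+: a := List.prefix_of_prefix_length_le
      ((List.prefix_append u w).trans hp) (List.prefix_append a _)
      (by simpa using hp.length_le)
    have hy : y ≠ [] := by
      rintro rfl
      rw [List.append_nil] at haw
      exact haw huw
    rw [List.append_assoc, List.prefix_append_right_inj] at hp
    exact hret.noEarly u y huret.ne_nil hy rfl (List.prefix_of_prefix_length_le (hvw.trans hp)
      ((List.prefix_append_right_inj y).2 hvw) (by simp))
  have hsum : S.len (a ++ w) + S.len (u ++ w) ≤ S.len w := by
    have haw0 : a ++ w ≠ [] := by simp [hw0]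
    have huw0 : u ++ w ≠ [] := by simp [hw0]
    rw [← ENNReal.ofReal_le_ofReal_iff (S.len_pos hw0).le,
      ENNReal.ofReal_add (S.len_pos haw0).le (S.len_pos huw0).le, ← S.volume_cyl hw0,
      ← S.volume_cyl haw0, ← S.volume_cyl huw0,
      ← measure_union hdisj (S.measurableSet_cyl huw0)]
    exact measure_mono (Set.union_subset (S.cyl_mono hw0 hwa)
      (S.cyl_mono hw0 huret.prefix_append))
  have h3 := mul_le_mul_of_nonneg_left hsum (Real.exp_pos (S.distC * ℓ)).le
  refine le_of_mul_le_mul_right ?_ (S.len_pos hw0)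
  linarith

/-- A lower bound for the measure of the cylinders met by recurrent words. -/
noncomputable def minMass : ℝ := Real.log (3 / 2) / S.distC

lemma minMass_pos : 0 < S.minMass := div_pos (Real.log_pos (by norm_num)) S.distC_pos

lemma IsTypical.le_volume_levelSet {x : ℝ} {ω : ℕ → Fin p} (h : S.IsTypical x ω) {n : ℕ}
    (hn : 0 < n) : ENNReal.ofReal S.minMass ≤ volume (S.levelSet (recWords ω) n) := by
  by_contra hlt
  obtain ⟨v, hv, rfl⟩ := exists_mem_recWords ω n
  have := (h.exists_forbidden S (List.length_pos_iff.1 hn) hv S.minMass_pos.le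
    (not_le.1 hlt).le).1
  rw [minMass, mul_div_cancel₀ _ S.distC_pos.ne', Real.exp_log (by norm_num)] at this
  norm_num at this

end ExpansiveMarkovSystem

lemma exists_mem_chain_forall {α : Type*} {c : Set (Set α)} (hc : IsChain (· ⊆ ·) c)
    (hne : c.Nonempty) {T : Set α} (hT : T.Finite) :
    ∃ L ∈ c, ∀ w ∈ T, w ∈ L → w ∈ ⋂₀ c := by
  induction T, hT using Set.Finite.induction_on with
  | empty =>
    obtain ⟨L, hL⟩ := hne
    exact ⟨L, hL, by simp⟩
  | @insert w T _ _ ih =>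
    obtain ⟨L, hL, h⟩ := ih
    by_cases hw : w ∈ ⋂₀ c
    · exact ⟨L, hL, fun u hu huL => (Set.mem_insert_iff.1 hu).elim (fun e => e ▸ hw)
        fun hu => h u hu huL⟩
    · simp only [Set.mem_sInter, not_forall] at hw
      obtain ⟨L', hL', hw⟩ := hw
      rcases hc.total hL hL' with hsub | hsub
      · exact ⟨L, hL, fun u hu huL => (Set.mem_insert_iff.1 hu).elim
          (fun e => absurd (hsub (e ▸ huL)) hw) fun hu => h u hu huL⟩
      · exact ⟨L', hL', fun u hu huL => (Set.mem_insert_iff.1 hu).elim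
          (fun e => absurd (e ▸ huL) hw) fun hu => h u hu (hsub huL)⟩

namespace ExpansiveMarkovSystem

variable {p : ℕ} (S : ExpansiveMarkovSystem p)

/-- A factor closed set of words whose level sets have measure bounded below. -/
structure IsMassive (L : Set (List (Fin p))) : Prop where
  factorClosed : FactorClosed L
  le_volume : ∀ n, ENNReal.ofReal S.minMass ≤ volume (S.levelSet L (n + 1))

lemma levelSet_mono {L L' : Set (List (Fin p))} {n : ℕ}
    (h : ∀ w ∈ L, w.length = n → w ∈ L') : S.levelSet L n ⊆ S.levelSet L' n := by
  intro x hx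
  obtain ⟨w, hw, hn, hx⟩ := S.mem_levelSet.1 hx
  exact S.mem_levelSet.2 ⟨w, h w hw hn, hn, hx⟩

lemma exists_minimal_isMassive {L₀ : Set (List (Fin p))} (h₀ : S.IsMassive L₀) :
    ∃ L, Minimal (· ∈ {L | S.IsMassive L}) L := by
  obtain ⟨L, -, hL⟩ := zorn_superset_nonempty {L | S.IsMassive L} (fun c hc hchain hne => by
    refine ⟨⋂₀ c, ⟨fun u v w h L hL => (hc hL).factorClosed u v w (h L hL), fun n => ?_⟩,
      fun L hL => Set.sInter_subset_of_mem hL⟩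
    obtain ⟨L, hL, h⟩ := exists_mem_chain_forall hchain hne (List.finite_length_eq (Fin p) (n + 1))
    exact ((hc hL).le_volume n).trans
      (measure_mono (S.levelSet_mono fun w hw hn => h w hn hw))) L₀ h₀
  exact ⟨L, hL⟩

lemma measurableSet_levelSet (L : Set (List (Fin p))) {n : ℕ} (hn : 0 < n) :
    MeasurableSet (S.levelSet L n) :=
  ((List.finite_length_eq (Fin p) n).subset fun _ hw => hw.2).measurableSet_biUnion fun w hw =>
    S.measurableSet_cyl (by rw [← List.length_pos_iff]; exact hw.2 ▸ hn)

lemma antitone_levelSet {L : Set (List (Fin p))} (hL : FactorClosed L) :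
    Antitone fun n => S.levelSet L (n + 1) := by
  refine antitone_nat_of_succ_le fun n x hx => ?_
  obtain ⟨w, hw, hlen, hx⟩ := S.mem_levelSet.1 hx
  have hpre := List.take_prefix (n + 1) w
  have hlen' : (w.take (n + 1)).length = n + 1 := by simp; omega
  exact S.mem_levelSet.2 ⟨_, hL.of_prefix hw hpre, hlen',
    S.cyl_mono (by rw [← List.length_pos_iff]; omega) hpre hx⟩

/-- The points all of whose cylinders come from `L`. -/
def coreSet (L : Set (List (Fin p))) : Set ℝ := ⋂ n, S.levelSet L (n + 1)

lemma IsMassive.le_volume_coreSet {L : Set (List (Fin p))} (h : S.IsMassive L) :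
    ENNReal.ofReal S.minMass ≤ volume (S.coreSet L) := by
  refine ge_of_tendsto' (tendsto_measure_iInter_atTop
    (fun n => (S.measurableSet_levelSet L n.succ_pos).nullMeasurableSet)
    (S.antitone_levelSet h.factorClosed) ⟨0, ?_⟩) h.le_volume
  refine ne_top_of_le_ne_top (b := volume S.I) (by simp [S.volume_I]) (measure_mono fun x hx => ?_)
  obtain ⟨w, -, -, hx⟩ := S.mem_levelSet.1 hx
  exact S.cyl_subset_I w hx

lemma exists_code_of_mem_coreSet {L : Set (List (Fin p))} (hL : FactorClosed L) {x : ℝ}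
    (hx : x ∈ S.coreSet L) :
    ∃ ω, S.HasCode x ω ∧ ∀ n w, Occ ω n w → w ∈ L := by
  choose w hwL hwlen hxw using fun n => S.mem_levelSet.1 (Set.mem_iInter.1 hx n)
  have hpre : ∀ m n, m ≤ n → w m <+: w n := fun m n hmn => by
    rcases S.prefix_or_prefix_of_mem (hxw m) (hxw n) with h | h
    · exact h
    · have h1 := hwlen m
      have h2 := hwlen n
      have h3 := h.length_le
      rw [h.eq_of_length (by omega)]
  let ω : ℕ → Fin p := fun k => (w k)[k]'(by rw [hwlen]; omega)
  have hω : ∀ n, seg ω 0 (n + 1) = w n := fun n => by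
    refine List.ext_getElem (by simp [hwlen]) fun k hk hk' => ?_
    rw [seg_getElem]
    have hkn : k ≤ n := by
      rw [hwlen] at hk'
      omega
    simp only [zero_add, ω]
    exact (hpre k n hkn).getElem _
  refine ⟨ω, fun n => ?_, fun n u hu => ?_⟩
  · rw [wordOf_eq_seg]
    cases n with
    | zero => exact S.cyl_subset_I _ (hxw 0)
    | succ n => rw [hω]; exact hxw n
  · have h1 : seg ω 0 n ++ u ++ seg ω (n + u.length) 1 ∈ L := by
      have h2 : seg ω 0 n ++ u = seg ω 0 (n + u.length) := by rw [seg_add, zero_add, hu]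
      have h3 := seg_add ω 0 (n + u.length) 1
      rw [zero_add] at h3
      rw [h2, ← h3, hω]
      exact hwL _
    exact hL _ _ _ h1

lemma IsTypical.isPorousAt_coreSet {L : Set (List (Fin p))} (hL : FactorClosed L) {x : ℝ}
    {ω : ℕ → Fin p} (h : S.IsTypical x ω) (hrec : recWords ω = L) :
    IsPorousAt (S.coreSet L) x := by
  have hK := S.distK_pos
  refine ⟨9 / 10 / (S.distK * S.distK), by positivity, fun ε hε => ?_⟩
  obtain ⟨N, hN⟩ := S.hgen ε hε
  obtain ⟨v, hv, hlen⟩ := exists_mem_recWords ω (N + 1)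
  have hv0 : v ≠ [] := by rw [← List.length_pos_iff]; omega
  have hvol : volume (S.levelSet (recWords ω) v.length) ≤ ENNReal.ofReal S.lenI := by
    rw [← S.volume_I]
    refine measure_mono fun y hy => ?_
    obtain ⟨w, -, -, hy⟩ := S.mem_levelSet.1 hy
    exact S.cyl_subset_I w hy
  obtain ⟨-, a, w, hw, hvw, hwa, haw, hle⟩ := h.exists_forbidden S hv0 hv S.lenI_nonneg hvol
  have hw0 : w ≠ [] := by rintro rfl; exact hv0 (List.prefix_nil.1 hvw)
  have hwN := hvw.length_le
  have hex : ∃ m, Occ ω m w := hw.exists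
  have hm := Nat.find_spec hex
  set m := Nat.find hex with hm_def
  have hearly : NoEarly (seg ω 0 m) w := fun t s ht hs hts =>
    noEarly_seg (by rwa [zero_add]) (fun j _ hj => by
      rw [zero_add]
      exact Nat.find_min hex hj) ht hs hts
  have hx : x ∈ S.cyl (seg ω 0 m ++ w) :=
    h.hasCode.mem_cyl S (occ_append.2 ⟨occ_seg ω 0 m, by simpa using hm⟩)
  have hsub : S.cyl (seg ω 0 m ++ (a ++ w)) ⊆ S.cyl (seg ω 0 m ++ w) :=
    S.cyl_mono (by simp [hw0]) ((List.prefix_append_right_inj _).2 hwa)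
  have huw : seg ω 0 m ++ w ≠ [] := by simp [hw0]
  have huaw : seg ω 0 m ++ (a ++ w) ≠ [] := by simp [hw0]
  obtain ⟨s, t, hst, hIcc⟩ := S.cyl_eq_Icc huaw
  have hlen_st : |s - t| = S.len (seg ω 0 m ++ (a ++ w)) := by
    rw [ExpansiveMarkovSystem.len, hIcc, Real.diam_Icc hst.le, abs_sub_comm,
      abs_of_pos (sub_pos.2 hst)]
  refine ⟨s, t, S.len (seg ω 0 m ++ w), S.len_pos huw, hN _ (by simp; omega), ?_, ?_, ?_⟩
  · rw [Set.uIcc_of_le hst.le, ← hIcc]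
    intro y hy
    rw [Metric.mem_closedBall, Real.dist_eq]
    exact S.abs_sub_le_len huw (hsub hy) hx
  · rw [Set.uIcc_of_le hst.le, ← hIcc, Set.disjoint_left]
    intro z hz hzL
    obtain ⟨η, hη, hηL⟩ := S.exists_code_of_mem_coreSet hL hzL
    exact haw (hrec ▸ hL.of_suffix (hηL 0 _ (hη.occ S hz)))
  · rw [hlen_st]
    have h1 := S.len_le_append (seg ω 0 m) hw0 hwa
    have h2 := S.exp_tot_le (S.tot_le_lenI hw0 hearly)
    have hlw := S.len_pos hw0
    have hlu := S.len_pos huw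
    have hlua := S.len_pos huaw
    change 9 / 10 * S.len w ≤ S.distK * S.len (a ++ w) at hle
    rw [div_mul_eq_mul_div, div_le_iff₀ (by positivity)]
    refine le_of_mul_le_mul_right ?_ hlw
    calc _ = S.len (seg ω 0 m ++ w) * (9 / 10 * S.len w) := by ring
      _ ≤ S.len (seg ω 0 m ++ w) * (S.distK * S.len (a ++ w)) := by gcongr
      _ = S.distK * (S.len (seg ω 0 m ++ w) * S.len (a ++ w)) := by ring
      _ ≤ S.distK * (S.distK * S.len (seg ω 0 m ++ (a ++ w)) * S.len w) := by
        refine mul_le_mul_of_nonneg_left (h1.trans ?_) hK.le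
        gcongr
        exact h2
      _ = _ := by ring

/-- The points of the full limit set without a typical coding. -/
def exceptionalSet : Set ℝ :=
  {x ∈ S.fullSet | IsPorousAt S.fullSet x} ∪ {x | ∃ ω, EventuallyPeriodic ω ∧ S.HasCode x ω}

lemma volume_exceptionalSet : volume S.exceptionalSet = 0 :=
  measure_union_null (volume_isPorousAt _) S.volume_eventuallyPeriodic

lemma isTypical_of_notMem {x : ℝ} {ω : ℕ → Fin p} (hx : S.HasCode x ω)
    (h : x ∉ S.exceptionalSet) : S.IsTypical x ω :=
  ⟨hx, fun hp => h (Or.inl ⟨⟨ω, hx⟩, hp⟩), fun hp => h (Or.inr ⟨ω, hp, hx⟩)⟩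

lemma IsTypical.isMassive {x : ℝ} {ω : ℕ → Fin p} (h : S.IsTypical x ω) :
    S.IsMassive (recWords ω) :=
  ⟨factorClosed_recWords ω, fun n => h.le_volume_levelSet S n.succ_pos⟩

lemma volume_fullSet : volume S.fullSet = 0 := by
  refine measure_mono_null ?_ S.volume_exceptionalSet
  rintro x ⟨ω, hω⟩
  by_contra hx
  obtain ⟨L, hL⟩ := S.exists_minimal_isMassive (S.isTypical_of_notMem hω hx).isMassive
  have hmass : S.IsMassive L := hL.1
  have hcore : S.coreSet L ⊆
      S.exceptionalSet ∪ {y ∈ S.coreSet L | IsPorousAt (S.coreSet L) y} := by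
    intro y hy
    by_cases hex : y ∈ S.exceptionalSet
    · exact Or.inl hex
    obtain ⟨η, hη, hηL⟩ := S.exists_code_of_mem_coreSet hmass.factorClosed hy
    have htyp := S.isTypical_of_notMem hη hex
    have hsub : recWords η ⊆ L := fun w hw => by
      obtain ⟨n, hn⟩ := hw.exists
      exact hηL n w hn
    exact Or.inr ⟨hy, htyp.isPorousAt_coreSet S hmass.factorClosed
      (hsub.antisymm (hL.2 htyp.isMassive hsub))⟩
  have hnull := measure_mono_null hcore
    (measure_union_null S.volume_exceptionalSet (volume_isPorousAt _))
  have := hmass.le_volume_coreSet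
  rw [hnull, nonpos_iff_eq_zero, ENNReal.ofReal_eq_zero] at this
  exact absurd S.minMass_pos (not_lt.2 this)

end ExpansiveMarkovSystem

/-- Let `(Λ_Q, f)` be a `C^{1+Lip}` expansive and transitive Markov system.
Then the set `Λ_Q` has Lebesgue measure zero. -/
theorem limitSet_volume_zero {p : ℕ} (S : ExpansiveMarkovSystem p) :
    MeasureTheory.volume S.limitSet = 0 := by
  exact measure_mono_null S.limitSet_subset_fullSet S.volume_fullSet
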